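/- Let A = kQ/I be a (locally) gentle algebra. Then depth(A) = 0 if A has a finite maximal path, and depth(A) = 1 otherwise. -/

import Mathlib

/- Common framework for (locally) gentle algebras -/

noncomputable section
open scoped BigOperators
open CategoryTheory

namespace LocGentle

/-- A finite connected quiver with at least one vertex and one arrow. -/
structure Quiv where
  V : Type
  Arr : Type
  [fintypeV : Fintype V]
  [fintypeA : Fintype Arr]
  [decEqV : DecidableEq V]
  [decEqA : DecidableEq Arr]
  src : Arr → V
  tgt : Arr → V
  [nonemptyV : Nonempty V]
  [nonemptyA : Nonempty Arr]
  connected : (SimpleGraph.fromRel (fun v w => ∃ a, src a = v ∧ tgt a = w)).Connected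

attribute [instance] Quiv.fintypeV Quiv.fintypeA Quiv.decEqV Quiv.decEqA
  Quiv.nonemptyV Quiv.nonemptyA

variable (Q : Quiv)

/-- in-degree of a vertex -/
def indeg (v : Q.V) : ℕ := (Finset.univ.filter (fun a => Q.tgt a = v)).card

/-- out-degree of a vertex -/
def outdeg (v : Q.V) : ℕ := (Finset.univ.filter (fun a => Q.src a = v)).card

/-- a list of arrows is composable (forms a path) -/
def Composable (l : List Q.Arr) : Prop := l.Chain' (fun a b => Q.tgt a = Q.src b)

variable {Q}

/-- source vertex of a nonempty word -/
def wSrc? (l : List Q.Arr) : Option Q.V := l.head?.map Q.src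

/-- target vertex of a nonempty word -/
def wTgt? (l : List Q.Arr) : Option Q.V := l.getLast?.map Q.tgt

/-- target of a word, with a default value (used for stationary paths) -/
def wTgtD (l : List Q.Arr) (v : Q.V) : Q.V := (l.getLast?.map Q.tgt).getD v

/-- last arrow of a word, with a (junk) default -/
def wLast (l : List Q.Arr) : Q.Arr := l.getLast?.getD (Classical.arbitrary _)

variable (rel : Q.Arr → Q.Arr → Prop)

/-- A word is allowed (is a basis path of `A = kQ/I`) if consecutive arrows are
composable and no consecutive pair lies in the relation set generating `I`. -/
def AllowedWord (l : List Q.Arr) : Prop :=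
  l.Chain' (fun a b => Q.tgt a = Q.src b ∧ ¬ rel a b)

/-- right maximal paths (of positive length) -/
def RightMaxWord (l : List Q.Arr) : Prop :=
  l ≠ [] ∧ AllowedWord rel l ∧ ∀ a : Q.Arr, ¬ AllowedWord rel (l ++ [a])

/-- left maximal paths (of positive length) -/
def LeftMaxWord (l : List Q.Arr) : Prop :=
  l ≠ [] ∧ AllowedWord rel l ∧ ∀ a : Q.Arr, ¬ AllowedWord rel (a :: l)

/-- finite maximal paths -/
def FiniteMaxWord (l : List Q.Arr) : Prop := RightMaxWord rel l ∧ LeftMaxWord rel l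

/-- a word is primitive if it is not a proper power -/
def PrimitiveWord (l : List Q.Arr) : Prop :=
  ∀ (l' : List Q.Arr) (n : ℕ), 2 ≤ n → l ≠ (List.replicate n l').flatten

/-- a primitive cycle `c` with `c² ∉ I`; these represent the infinite maximal paths `c^∞`. -/
def PrimCycleSq (c : List Q.Arr) : Prop :=
  c ≠ [] ∧ AllowedWord rel (c ++ c) ∧ wTgt? c = wSrc? c ∧ PrimitiveWord c

/-- the maximal path `γ_α` containing `α` is infinite -/
def InfThrough (a : Q.Arr) : Prop := ∃ c, PrimCycleSq rel c ∧ a ∈ c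

/-- the maximal path `γ_α` containing `α` is finite -/
def FinThrough (a : Q.Arr) : Prop := ∃ l, FiniteMaxWord rel l ∧ a ∈ l

/-- the rotation of the cycle `c` starting at the arrow `a`; when `a ∈ c` and `c` has no
duplicates this is the primitive cycle `γ_r(a)`. -/
def rotTo (c : List Q.Arr) (a : Q.Arr) : List Q.Arr :=
  c.dropWhile (fun b => b != a) ++ c.takeWhile (fun b => b != a)

/-- the relation set of the Koszul dual `A#`; its allowed words are the forbidden paths of `A`. -/
def dualRel : Q.Arr → Q.Arr → Prop := fun a b => Q.tgt a = Q.src b ∧ ¬ rel a b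

/-- a forbidden path of `A`, i.e. a path of the Koszul dual `A#` -/
def ForbiddenWord (l : List Q.Arr) : Prop := AllowedWord (dualRel rel) l

variable (Q)

/-- The defining conditions (i)-(iv) of a (locally) gentle algebra, in terms of the set of
length-two relations generating the ideal `I`: an algebra satisfying them is gentle if it
is finite dimensional and locally gentle otherwise. -/
structure IsGentleRel : Prop where
  indeg_le : ∀ v : Q.V, indeg Q v ≤ 2
  outdeg_le : ∀ v : Q.V, outdeg Q v ≤ 2
  rel_comp : ∀ a b : Q.Arr, rel a b → Q.tgt a = Q.src b
  cond_ii : ∀ a b b' : Q.Arr, b ≠ b' → Q.tgt b = Q.src a → Q.tgt b' = Q.src a →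
    Xor' (rel b a) (rel b' a)
  cond_iii : ∀ a b b' : Q.Arr, b ≠ b' → Q.tgt a = Q.src b → Q.tgt a = Q.src b' →
    Xor' (rel a b) (rel a b')

/-- `Q` is (as a quiver) the extended Dynkin quiver `Ã_n` (for `n = |Q₀| - 1`):
every vertex has in-degree and out-degree one. -/
def IsAtilde : Prop := ∀ v : Q.V, indeg Q v = 1 ∧ outdeg Q v = 1

/-- paths of `Q`, including the stationary paths (`w = []`) at each vertex -/
structure Pth where
  s : Q.V
  w : List Q.Arr
  hs : ∀ a ∈ w.head?, Q.src a = s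
  hc : Composable Q w

variable {Q}

/-- target of a path -/
def Pth.t (p : Pth Q) : Q.V := wTgtD p.w p.s

/-- length of a path -/
def Pth.len (p : Pth Q) : ℕ := p.w.length

/-- a basis path of `A = kQ/I` -/
def Pth.Allowed (p : Pth Q) : Prop := AllowedWord rel p.w

end LocGentle
namespace LocGentle

variable (k : Type) [Field k] (Q : Quiv) (rel : Q.Arr → Q.Arr → Prop)

/-- The defining relations presenting `A = kQ/I` as a quotient of the free algebra on
the stationary paths (vertices) and arrows: the path algebra relations together with
the relations `αβ = 0` for the length-two paths `αβ` generating `I`. -/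
inductive GARel : FreeAlgebra k (Q.V ⊕ Q.Arr) → FreeAlgebra k (Q.V ⊕ Q.Arr) → Prop
  | idem (v : Q.V) : GARel (FreeAlgebra.ι k (Sum.inl v) * FreeAlgebra.ι k (Sum.inl v))
      (FreeAlgebra.ι k (Sum.inl v))
  | orth (v w : Q.V) : v ≠ w → GARel (FreeAlgebra.ι k (Sum.inl v) * FreeAlgebra.ι k (Sum.inl w)) 0
  | unit : GARel (∑ v : Q.V, FreeAlgebra.ι k (Sum.inl v)) 1
  | src_mul (a : Q.Arr) : GARel (FreeAlgebra.ι k (Sum.inl (Q.src a)) * FreeAlgebra.ι k (Sum.inr a))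
      (FreeAlgebra.ι k (Sum.inr a))
  | mul_tgt (a : Q.Arr) : GARel (FreeAlgebra.ι k (Sum.inr a) * FreeAlgebra.ι k (Sum.inl (Q.tgt a)))
      (FreeAlgebra.ι k (Sum.inr a))
  | src_zero (v : Q.V) (a : Q.Arr) : v ≠ Q.src a →
      GARel (FreeAlgebra.ι k (Sum.inl v) * FreeAlgebra.ι k (Sum.inr a)) 0
  | tgt_zero (v : Q.V) (a : Q.Arr) : v ≠ Q.tgt a →
      GARel (FreeAlgebra.ι k (Sum.inr a) * FreeAlgebra.ι k (Sum.inl v)) 0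
  | rel_zero (a b : Q.Arr) : rel a b →
      GARel (FreeAlgebra.ι k (Sum.inr a) * FreeAlgebra.ι k (Sum.inr b)) 0

/-- The (locally) gentle algebra `A = kQ/I`. -/
abbrev GA := RingQuot (GARel k Q rel)

/-- the image in `A` of the stationary path at `v` -/
def vtx (v : Q.V) : GA k Q rel := RingQuot.mkAlgHom k _ (FreeAlgebra.ι k (Sum.inl v))

/-- the image in `A` of the arrow `a` -/
def arr (a : Q.Arr) : GA k Q rel := RingQuot.mkAlgHom k _ (FreeAlgebra.ι k (Sum.inr a))

/-- the image in `A` of the word `l` (the product of its arrows) -/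
def wordEl (l : List Q.Arr) : GA k Q rel := (l.map (arr k Q rel)).prod

variable {Q}

/-- the image in `A` of a path (a stationary path maps to the corresponding idempotent) -/
def Pth.el (p : Pth Q) : GA k Q rel := vtx k Q rel p.s * wordEl k Q rel p.w

variable (Q)

/-- the `n`-th graded component `A_n` of `A`, spanned by the images of paths of length `n` -/
def deg (n : ℕ) : Submodule k (GA k Q rel) :=
  Submodule.span k {x | ∃ p : Pth Q, p.Allowed rel ∧ p.len = n ∧ x = p.el k rel}

/-- the augmentation ideal `A₊` (as a `k`-submodule), spanned by paths of positive length -/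
def degPlus : Submodule k (GA k Q rel) :=
  Submodule.span k {x | ∃ p : Pth Q, p.Allowed rel ∧ 1 ≤ p.len ∧ x = p.el k rel}

/-- the Hilbert series of `A` (with integer coefficients) -/
def hilb : PowerSeries ℤ :=
  PowerSeries.mk fun n => (Module.finrank k (deg k Q rel n) : ℤ)

/-- the Hilbert series of `A` (with rational coefficients) -/
def hilbQ : PowerSeries ℚ :=
  PowerSeries.mk fun n => (Module.finrank k (deg k Q rel n) : ℚ)

/-- the number `k_n` of finite maximal paths of length at least `n` -/
def numFMP (n : ℕ) : ℕ := {l : List Q.Arr | FiniteMaxWord rel l ∧ n ≤ l.length}.ncard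

/-- the Gelfand-Kirillov dimension of `A`:
`limsup_n log (dim_k A_{≤ n}) / log n`. -/
def GKdim : ℝ :=
  Filter.limsup (fun n : ℕ =>
      Real.log (Module.finrank k ↥(⨆ i ∈ Finset.range (n + 1), deg k Q rel i)) / Real.log n)
    Filter.atTop

/-- the central element `m_γ` attached to the infinite maximal path `γ = c^∞`:
the sum over the arrows `α` of `c` of the primitive cycle `γ_r(α)` starting at `α`. -/
def mEl (c : List Q.Arr) : GA k Q rel := (c.map fun a => wordEl k Q rel (rotTo c a)).sum

/-- evaluation of a polynomial at `x ∈ A`; `polyEval k Q rel p x` is `p(x)`. -/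
def polyEval (p : Polynomial k) (x : GA k Q rel) : GA k Q rel :=
  Polynomial.eval₂ (algebraMap k (GA k Q rel)) x p

end LocGentle
namespace LocGentle

variable (k : Type) [Field k] (Q : Quiv) (rel : Q.Arr → Q.Arr → Prop)

/-! ### Two-sided ideals and primes -/

/-- a prime (two-sided) ideal -/
def IsPrimeTI (P : TwoSidedIdeal (GA k Q rel)) : Prop :=
  P ≠ ⊤ ∧ ∀ x y : GA k Q rel, (∀ a : GA k Q rel, x * a * y ∈ P) → x ∈ P ∨ y ∈ P

/-- the maximal ideal `𝔪_v` of `A` which does not contain `ε_v`: it is generated by the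
stationary paths at the other vertices together with all loops at `v`. -/
def mIdeal (v : Q.V) : TwoSidedIdeal (GA k Q rel) :=
  TwoSidedIdeal.span
    ({x | ∃ w : Q.V, w ≠ v ∧ x = vtx k Q rel w} ∪
     {x | ∃ a : Q.Arr, Q.src a = v ∧ Q.tgt a = v ∧ x = arr k Q rel a})

/-- the ideal `J_γ` corresponding to the infinite maximal path `γ = c^∞`, generated by
all arrows lying on `γ` -/
def Jgamma (c : List Q.Arr) : TwoSidedIdeal (GA k Q rel) :=
  TwoSidedIdeal.span {x | ∃ a ∈ c, x = arr k Q rel a}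

/-- the left annihilator of `J_γ` -/
def annJ (c : List Q.Arr) : Set (GA k Q rel) :=
  {x | ∀ y ∈ Jgamma k Q rel c, x * y = 0}

/-! ### The simple modules `S(v)`, and `Ext` groups -/

/-- the algebra map `A → k` corresponding to the vertex `v` (projection onto the
coefficient of `ε_v`) -/
def vtxHomAux (v : Q.V) : FreeAlgebra k (Q.V ⊕ Q.Arr) →ₐ[k] k :=
  FreeAlgebra.lift k (Sum.elim (fun w => if w = v then (1 : k) else 0) (fun _ => 0))

theorem vtxHomAux_rel (v : Q.V) : ∀ ⦃x y⦄, GARel k Q rel x y →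
    vtxHomAux k Q v x = vtxHomAux k Q v y := by
  intro x y h
  cases h with
  | idem w =>
      simp only [vtxHomAux, map_mul, FreeAlgebra.lift_ι_apply, Sum.elim_inl]
      split_ifs <;> simp
  | orth w w' hne =>
      simp only [vtxHomAux, map_mul, FreeAlgebra.lift_ι_apply, Sum.elim_inl, map_zero]
      split_ifs with h1 h2 <;> first | (exact absurd (h1.trans h2.symm) hne) | simp
  | unit =>
      simp only [vtxHomAux, map_sum, FreeAlgebra.lift_ι_apply, Sum.elim_inl, map_one]
      simp [Finset.sum_ite_eq' Finset.univ v (fun _ => (1:k))]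
  | src_mul a =>
      simp [vtxHomAux, map_mul, FreeAlgebra.lift_ι_apply]
  | mul_tgt a =>
      simp [vtxHomAux, map_mul, FreeAlgebra.lift_ι_apply]
  | src_zero w a hw =>
      simp [vtxHomAux, map_mul, FreeAlgebra.lift_ι_apply]
  | tgt_zero w a hw =>
      simp [vtxHomAux, map_mul, FreeAlgebra.lift_ι_apply]
  | rel_zero a b hab =>
      simp [vtxHomAux, map_mul, FreeAlgebra.lift_ι_apply]

/-- the ring map `A → k` corresponding to the vertex `v` -/
def vtxHom (v : Q.V) : GA k Q rel →+* k :=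
  RingQuot.lift ⟨(vtxHomAux k Q v).toRingHom, fun _ _ h => vtxHomAux_rel k Q rel v h⟩

/-- the ring map `A → k^{Q₀}` with kernel `A₊` -/
def SHom : GA k Q rel →+* (Q.V → k) := Pi.ringHom fun v => vtxHom k Q rel v

/-- the graded simple right `A`-module `S(v)` at the vertex `v` -/
def SvModR (v : Q.V) : ModuleCat (GA k Q rel)ᵐᵒᵖ :=
  @ModuleCat.of _ _ k _
    (Module.compHom k ((vtxHom k Q rel v).fromOpposite (fun _ _ => mul_comm _ _)))

/-- the graded simple left `A`-module `S(v)` at the vertex `v` -/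
def SvModL (v : Q.V) : ModuleCat (GA k Q rel) :=
  @ModuleCat.of _ _ k _ (Module.compHom k (vtxHom k Q rel v))

/-- `S = A/A₊ ≅ ⊕_v S(v)` as a right `A`-module -/
def SModR : ModuleCat (GA k Q rel)ᵐᵒᵖ :=
  @ModuleCat.of _ _ (Q.V → k) _
    (Module.compHom _ ((SHom k Q rel).fromOpposite (fun _ _ => mul_comm _ _)))

/-- `S = A/A₊` as a left `A`-module -/
def SModL : ModuleCat (GA k Q rel) :=
  @ModuleCat.of _ _ (Q.V → k) _ (Module.compHom _ (SHom k Q rel))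

/-- `A` as a right module over itself -/
def AModR : ModuleCat (GA k Q rel)ᵐᵒᵖ := ModuleCat.of _ (GA k Q rel)

/-- `A` as a left module over itself -/
def AModL : ModuleCat (GA k Q rel) := ModuleCat.of _ (GA k Q rel)

/-- nonvanishing of `Ext^i(M, N)` for modules over a ring `R` -/
def extNZ {R : Type} [Ring R] (i : ℕ) (M N : ModuleCat R) : Prop :=
  ¬ Subsingleton (((Ext ℤ (ModuleCat R) i).obj (Opposite.op M)).obj N)

/-- nonvanishing of `Ext^i_A(S(v), A)` in right `A`-modules.  (For the Noetherian graded
algebra `A` with the finitely generated modules `S(v)` and `A` this agrees with the graded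
`Ext`-group, summed over all shifts, used in the paper.) -/
def extSvNZ (i : ℕ) (v : Q.V) : Prop := extNZ i (SvModR k Q rel v) (AModR k Q rel)

/-- nonvanishing of `Ext^i_A(S, A)` in right `A`-modules -/
def extSNZ (i : ℕ) : Prop := extNZ i (SModR k Q rel) (AModR k Q rel)

/-- the depth of `A`: `min { i : Ext^i_A(S, A) ≠ 0 }` -/
def depth : ℕ∞ := sInf {n : ℕ∞ | ∃ i : ℕ, n = i ∧ extSNZ k Q rel i}

/-- the right self-injective dimension of `A`:
`sup { i : Ext^i(M, A) ≠ 0 for some right module M }` -/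
def rInjDim : ℕ∞ :=
  sSup {n : ℕ∞ | ∃ (i : ℕ) (M : ModuleCat.{0} (GA k Q rel)ᵐᵒᵖ), n = i ∧ extNZ i M (AModR k Q rel)}

/-- the left self-injective dimension of `A` -/
def lInjDim : ℕ∞ :=
  sSup {n : ℕ∞ | ∃ (i : ℕ) (M : ModuleCat.{0} (GA k Q rel)), n = i ∧ extNZ i M (AModL k Q rel)}

/-- the right global dimension of `A`: `sup { i : Ext^i(M, N) ≠ 0 }` over right modules -/
def rGlDim : ℕ∞ :=
  sSup {n : ℕ∞ | ∃ (i : ℕ) (M N : ModuleCat.{0} (GA k Q rel)ᵐᵒᵖ), n = i ∧ extNZ i M N}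

/-- the left global dimension of `A` -/
def lGlDim : ℕ∞ :=
  sSup {n : ℕ∞ | ∃ (i : ℕ) (M N : ModuleCat.{0} (GA k Q rel)), n = i ∧ extNZ i M N}

end LocGentle
namespace LocGentle

theorem subsingleton_ext_iff {R : Type} [Ring R] {M : ModuleCat.{0} R}
    (P : ProjectiveResolution M) (N : ModuleCat.{0} R) (i : ℕ) :
    Subsingleton (((Ext ℤ (ModuleCat.{0} R) i).obj (Opposite.op M)).obj N) ↔
      (P.complex.linearYonedaObj ℤ N).ExactAt i := by
  rw [HomologicalComplex.exactAt_iff_isZero_homology, ← (P.isoExt i N).isZero_iff,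
    ModuleCat.isZero_iff_subsingleton]

theorem subsingleton_ext_zero_iff {R : Type} [Ring R] {M : ModuleCat.{0} R}
    (P : ProjectiveResolution M) (N : ModuleCat.{0} R) :
    Subsingleton (((Ext ℤ (ModuleCat.{0} R) 0).obj (Opposite.op M)).obj N) ↔
      ∀ f : P.complex.X 0 ⟶ N, P.complex.d 1 0 ≫ f = 0 → f = 0 := by
  rw [subsingleton_ext_iff P, HomologicalComplex.exactAt_iff' _ 0 0 1 (by simp) (by simp),
    ShortComplex.moduleCat_exact_iff]
  refine forall_congr' fun f => imp_congr_right fun _ => ?_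
  constructor
  · rintro ⟨g, rfl⟩
    have hg : ∀ g : P.complex.X 0 ⟶ N, P.complex.d 0 0 ≫ g = 0 := fun g => by
      rw [P.complex.shape 0 0 (by simp), Limits.zero_comp]
    exact hg g
  · rintro rfl
    exact ⟨0, map_zero _⟩

theorem subsingleton_ext_one_iff {R : Type} [Ring R] {M : ModuleCat.{0} R}
    (P : ProjectiveResolution M) (N : ModuleCat.{0} R) :
    Subsingleton (((Ext ℤ (ModuleCat.{0} R) 1).obj (Opposite.op M)).obj N) ↔
      ∀ f : P.complex.X 1 ⟶ N, P.complex.d 2 1 ≫ f = 0 →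
        ∃ g : P.complex.X 0 ⟶ N, P.complex.d 1 0 ≫ g = f := by
  rw [subsingleton_ext_iff P, HomologicalComplex.exactAt_iff' _ 0 1 2 (by simp) (by simp),
    ShortComplex.moduleCat_exact_iff]
  rfl

theorem extNZ_zero_iff {R : Type} [Ring R] (M N : ModuleCat.{0} R) :
    extNZ 0 M N ↔ ∃ f : M ⟶ N, f ≠ 0 := by
  let P := projectiveResolution M
  let π : P.complex.X 0 ⟶ M := P.π.f 0
  have hπ : Epi π := inferInstanceAs (Epi (P.π.f 0))
  rw [extNZ, subsingleton_ext_zero_iff P]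
  push Not
  constructor
  · rintro ⟨f, hf, hf0⟩
    refine ⟨P.exact₀.desc f hf, fun h => hf0 ?_⟩
    rw [← P.exact₀.g_desc f hf]
    exact (congrArg (P.π.f 0 ≫ ·) h).trans Limits.comp_zero
  · rintro ⟨f, hf⟩
    refine ⟨π ≫ f, ?_, fun h => hf ?_⟩
    · rw [← Category.assoc, show P.complex.d 1 0 ≫ π = 0 from P.complex_d_comp_π_f_zero,
        Limits.zero_comp]
    · rwa [← cancel_epi π, Limits.comp_zero]

theorem exists_extension_of_not_extNZ_one {R : Type} [Ring R] {M N K F : ModuleCat.{0} R}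
    (k : K ⟶ F) (ε : F ⟶ M) (w : k ≫ ε = 0) (hS : (ShortComplex.mk k ε w).Exact) [Mono k] [Epi ε]
    [Projective F] (h : ¬ extNZ 1 M N) (φ : K ⟶ N) : ∃ ψ : F ⟶ N, k ≫ ψ = φ := by
  let P := projectiveResolution M
  let π : P.complex.X 0 ⟶ M := P.π.f 0
  have hπ : Epi π := inferInstanceAs (Epi (P.π.f 0))
  have hdπ : P.complex.d 1 0 ≫ π = 0 := P.complex_d_comp_π_f_zero
  have hP : (ShortComplex.mk (P.complex.d 1 0) π hdπ).Exact := P.exact₀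
  rw [extNZ, not_not, subsingleton_ext_one_iff P] at h
  let g : P.complex.X 0 ⟶ F := Projective.factorThru π ε
  have hg : g ≫ ε = π := Projective.factorThru_comp π ε
  let g' : F ⟶ P.complex.X 0 := Projective.factorThru ε π
  have hg' : g' ≫ π = ε := Projective.factorThru_comp ε π
  have hl : (P.complex.d 1 0 ≫ g) ≫ ε = 0 := by rw [Category.assoc, hg, hdπ]
  have hr : (g' ≫ g - 𝟙 F) ≫ ε = 0 := by simp [hg, hg']
  obtain ⟨l, hl⟩ : ∃ l : P.complex.X 1 ⟶ K, l ≫ k = P.complex.d 1 0 ≫ g :=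
    ⟨hS.lift _ hl, hS.lift_f _ hl⟩
  obtain ⟨r, hr⟩ : ∃ r : F ⟶ K, r ≫ k = g' ≫ g - 𝟙 F := ⟨hS.lift _ hr, hS.lift_f _ hr⟩
  have hdl : P.complex.d 2 1 ≫ l = 0 := by
    rw [← cancel_mono k, Category.assoc, hl]
    simp
  obtain ⟨q, hq⟩ := h (l ≫ φ) (by rw [← Category.assoc, hdl, Limits.zero_comp])
  obtain ⟨X, e, he, m, hm⟩ := hP.exact_up_to_refinements (k ≫ g')
    (by change (k ≫ g') ≫ π = 0; rw [Category.assoc, hg', w])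
  replace hm : e ≫ k ≫ g' = m ≫ P.complex.d 1 0 := hm
  have hml : m ≫ l = e + e ≫ k ≫ r := by
    rw [← cancel_mono k, Category.assoc, hl, ← Category.assoc, ← hm]
    simp [hr]
  refine ⟨g' ≫ q - r ≫ φ, ?_⟩
  rw [← cancel_epi e]
  have : e ≫ k ≫ g' ≫ q = (e + e ≫ k ≫ r) ≫ φ := by
    rw [← hml, Category.assoc, ← hq, ← Category.assoc m, ← hm]
    simp
  simp [this]
section Combinatorics

variable {Q : Quiv} {rel : Q.Arr → Q.Arr → Prop}

/-- `b` can follow `a` in a basis path of `A`. -/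
def Follows (rel : Q.Arr → Q.Arr → Prop) (a b : Q.Arr) : Prop := Q.tgt a = Q.src b ∧ ¬ rel a b

theorem Follows.eq_of_left (h : IsGentleRel Q rel) {a b b' : Q.Arr} (hb : Follows rel a b)
    (hb' : Follows rel a b') : b = b' := by
  by_contra hne
  rcases h.cond_iii a b b' hne hb.1 hb'.1 with h' | h'
  · exact hb.2 h'.1
  · exact hb'.2 h'.1

/-- There is a finite maximal path as soon as some arrow cannot be followed by any arrow. -/
theorem exists_finiteMaxWord (h : IsGentleRel Q rel) {a : Q.Arr} (ha : ∀ b, ¬ Follows rel a b) :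
    ∃ l : List Q.Arr, FiniteMaxWord rel l := by
  by_contra hno
  have key : ∀ x : {x // Relation.ReflTransGen (Follows rel) x a},
      ∃ y : {x // Relation.ReflTransGen (Follows rel) x a}, Follows rel y x := by
    rintro ⟨x, hx⟩
    by_contra hy
    obtain ⟨l, hl, hlast⟩ := List.exists_isChain_cons_of_relationReflTransGen hx
    refine hno ⟨x :: l, ⟨by simp, hl, fun b hb => ?_⟩, ⟨by simp, hl, fun b hb => ?_⟩⟩
    · have := (List.isChain_append.1 hb).2.2 a (by
        rw [List.getLast?_eq_getLast_of_ne_nil (List.cons_ne_nil _ _), hlast]; rfl) b (by simp)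
      exact ha b this
    · have hbx : Follows rel b x := (List.isChain_cons_cons.1 hb).1
      exact hy ⟨⟨b, hx.head hbx⟩, hbx⟩
  choose p hp using key
  have hinj : Function.Injective p := fun x y hxy =>
    Subtype.ext ((hp x).eq_of_left h (hxy ▸ hp y))
  obtain ⟨x, hx⟩ := (Finite.injective_iff_surjective.1 hinj) ⟨a, .refl⟩
  exact ha x (by simpa [hx] using hp x)

theorem FiniteMaxWord.exists_not_follows {l : List Q.Arr} (hl : FiniteMaxWord rel l) :
    ∃ a : Q.Arr, ∀ b, ¬ Follows rel a b := by
  obtain ⟨⟨hne, hall, hmax⟩, -⟩ := hl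
  refine ⟨l.getLast hne, fun b hb => hmax b (List.isChain_append.2 ⟨hall, by simp, ?_⟩)⟩
  intro x hx y hy
  rw [List.getLast?_eq_getLast_of_ne_nil hne] at hx
  simp only [Option.mem_def, Option.some.injEq, List.head?_cons] at hx hy
  subst hx hy
  exact hb

/-- If every arrow can be followed, then every vertex is the source of an arrow. -/
theorem exists_src_eq (h : ∀ a : Q.Arr, ∃ b, Follows rel a b) (v : Q.V) : ∃ a, Q.src a = v := by
  obtain ⟨a⟩ := Q.nonemptyA
  obtain ⟨p⟩ := Q.connected.preconnected v (Q.src a)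
  cases p with
  | nil => exact ⟨a, rfl⟩
  | cons hadj _ =>
    rcases (SimpleGraph.fromRel_adj _ _ _).1 hadj with ⟨-, ⟨b, hb, -⟩ | ⟨b, -, hb⟩⟩
    · exact ⟨b, hb⟩
    · obtain ⟨c, hc⟩ := h b
      exact ⟨c, hc.1.symm.trans hb⟩

end Combinatorics

section PathModule

variable {k : Type} [Field k] {Q : Quiv} {rel : Q.Arr → Q.Arr → Prop}

theorem vtx_mul_self (v : Q.V) : vtx k Q rel v * vtx k Q rel v = vtx k Q rel v := by
  simpa [vtx] using RingQuot.mkAlgHom_rel k (GARel.idem (k := k) (rel := rel) v)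

theorem vtx_mul_of_ne {v w : Q.V} (h : v ≠ w) : vtx k Q rel v * vtx k Q rel w = 0 := by
  simpa [vtx] using RingQuot.mkAlgHom_rel k (GARel.orth (k := k) (rel := rel) v w h)

variable (k Q rel) in
theorem sum_vtx : ∑ v, vtx k Q rel v = 1 := by
  simpa [vtx] using RingQuot.mkAlgHom_rel k (GARel.unit (k := k) (Q := Q) (rel := rel))

theorem vtx_src_mul_arr (a : Q.Arr) : vtx k Q rel (Q.src a) * arr k Q rel a = arr k Q rel a := by
  simpa [vtx, arr] using RingQuot.mkAlgHom_rel k (GARel.src_mul (k := k) (rel := rel) a)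

theorem arr_mul_vtx_tgt (a : Q.Arr) : arr k Q rel a * vtx k Q rel (Q.tgt a) = arr k Q rel a := by
  simpa [vtx, arr] using RingQuot.mkAlgHom_rel k (GARel.mul_tgt (k := k) (rel := rel) a)

theorem vtx_mul_arr_of_ne {v : Q.V} {a : Q.Arr} (h : v ≠ Q.src a) :
    vtx k Q rel v * arr k Q rel a = 0 := by
  simpa [vtx, arr] using RingQuot.mkAlgHom_rel k (GARel.src_zero (k := k) (rel := rel) v a h)

theorem arr_mul_arr_of_rel {a b : Q.Arr} (h : rel a b) : arr k Q rel a * arr k Q rel b = 0 := by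
  simpa [arr] using RingQuot.mkAlgHom_rel k (GARel.rel_zero (k := k) a b h)

theorem mul_vtx_of_mul_vtx_eq {x : GA k Q rel} {v w : Q.V} (hx : x * vtx k Q rel v = x) :
    x * vtx k Q rel w = if v = w then x else 0 := by
  split_ifs with h
  · rw [← h, hx]
  · rw [← hx, mul_assoc, vtx_mul_of_ne h, mul_zero]

theorem mul_arr_of_mul_vtx_eq {x : GA k Q rel} {v : Q.V} {a : Q.Arr} (hx : x * vtx k Q rel v = x)
    (h : v ≠ Q.src a) : x * arr k Q rel a = 0 := by
  rw [← hx, mul_assoc, vtx_mul_arr_of_ne h, mul_zero]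

/-- To prove a property of elements of `A` it suffices to treat scalars and generators, sums and
products. -/
theorem GA.induction {P : GA k Q rel → Prop} (algebraMap : ∀ c, P (algebraMap k _ c))
    (vtx : ∀ v, P (vtx k Q rel v)) (arr : ∀ a, P (arr k Q rel a))
    (mul : ∀ x y, P x → P y → P (x * y)) (add : ∀ x y, P x → P y → P (x + y)) (x : GA k Q rel) :
    P x := by
  obtain ⟨x, rfl⟩ := RingQuot.mkAlgHom_surjective k (GARel k Q rel) x
  induction x using FreeAlgebra.induction with
  | grade0 c => simpa using algebraMap c
  | grade1 g => cases g with
    | inl v => exact vtx v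
    | inr a => exact arr a
  | mul x y hx hy => simpa using mul _ _ hx hy
  | add x y hx hy => simpa using add _ _ hx hy

variable (k Q) in
/-- The vector space on pairs of a starting vertex and a word, where words are written in reverse
order (the last arrow of the path comes first).  It carries a right action of `A` by extending
words, and contains `A` as a direct summand. -/
abbrev PathMod := (Q.V × List Q.Arr) →₀ k

/-- The vertex where the reversed word `p.2` started at `p.1` ends. -/
def endpt (p : Q.V × List Q.Arr) : Q.V := p.2.head?.elim p.1 Q.tgt

/-- The reversed word `p.2` started at `p.1` can be prolonged by the arrow `a`. -/
def CanExtend (rel : Q.Arr → Q.Arr → Prop) (p : Q.V × List Q.Arr) (a : Q.Arr) : Prop :=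
  endpt p = Q.src a ∧ ∀ b ∈ p.2.head?, ¬ rel b a

open Classical in
/-- The result of prolonging a reversed word by a vertex or an arrow. -/
def prolong (rel : Q.Arr → Q.Arr → Prop) (p : Q.V × List Q.Arr) : Q.V ⊕ Q.Arr → PathMod k Q
  | .inl v => if endpt p = v then Finsupp.single p 1 else 0
  | .inr a => if CanExtend rel p a then Finsupp.single (p.1, a :: p.2) 1 else 0

/-- The action of a generator on `PathMod`. -/
def genAct (rel : Q.Arr → Q.Arr → Prop) (g : Q.V ⊕ Q.Arr) : Module.End k (PathMod k Q) :=
  Finsupp.linearCombination k fun p => prolong rel p g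

@[simp]
theorem genAct_single (g : Q.V ⊕ Q.Arr) (p : Q.V × List Q.Arr) (c : k) :
    genAct rel g (Finsupp.single p c) = c • prolong rel p g := by
  simp [genAct]

/-- The right action of `A` on `PathMod`. -/
def actHom (rel : Q.Arr → Q.Arr → Prop) : GA k Q rel →ₐ[k] (Module.End k (PathMod k Q))ᵐᵒᵖ :=
  RingQuot.liftAlgHom k ⟨FreeAlgebra.lift k fun g => .op (genAct rel g), by
    intro x y h
    apply MulOpposite.unop_injective
    refine Finsupp.lhom_ext fun p c => ?_
    cases h with
    | idem v => by_cases h : endpt p = v <;> simp [prolong, h]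
    | orth v w hne =>
      by_cases h : endpt p = v <;> simp [prolong, h, hne]
    | unit => simp [prolong]
    | src_mul a =>
      by_cases h : endpt p = Q.src a <;> simp [prolong, h, CanExtend]
    | mul_tgt a =>
      by_cases h : CanExtend rel p a <;> simp [prolong, h, endpt]
    | src_zero v a hne =>
      by_cases h : endpt p = v <;> simp [prolong, h, CanExtend, hne]
    | tgt_zero v a hne =>
      by_cases h : CanExtend rel p a <;> simp [prolong, h, endpt, hne.symm]
    | rel_zero a b hab =>
      have hb : ¬ CanExtend rel (p.1, a :: p.2) b := by simp [CanExtend, hab]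
      by_cases h : CanExtend rel p a <;> simp [prolong, h, hb]⟩

/-- The right action of `A` on `PathMod`. -/
def act (m : PathMod k Q) (x : GA k Q rel) : PathMod k Q := (actHom rel x).unop m

theorem act_mul (m : PathMod k Q) (x y : GA k Q rel) : act m (x * y) = act (act m x) y := by
  simp [act]

theorem act_add (m : PathMod k Q) (x y : GA k Q rel) : act m (x + y) = act m x + act m y := by
  simp [act]

theorem act_algebraMap (m : PathMod k Q) (c : k) :
    act m (algebraMap k (GA k Q rel) c) = c • m := by
  simp [act]

theorem act_vtx (m : PathMod k Q) (v : Q.V) :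
    act m (vtx k Q rel v) = genAct rel (.inl v) m := by
  simp [act, actHom, vtx]

theorem act_arr (m : PathMod k Q) (a : Q.Arr) :
    act m (arr k Q rel a) = genAct rel (.inr a) m := by
  simp [act, actHom, arr]

/-- The sum of the stationary paths. -/
def PathMod.one : PathMod k Q := ∑ v : Q.V, Finsupp.single (v, []) 1

theorem PathMod.one_apply (v : Q.V) : (PathMod.one : PathMod k Q) (v, []) = 1 := by
  simp [PathMod.one, Finsupp.finsetSum_apply, Finsupp.single_apply]

/-- The embedding of `A` into `PathMod`. -/
def toPath (rel : Q.Arr → Q.Arr → Prop) : GA k Q rel →ₗ[k] PathMod k Q :=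
  LinearMap.applyₗ PathMod.one ∘ₗ (MulOpposite.opLinearEquiv k).symm.toLinearMap ∘ₗ
    (actHom rel).toLinearMap

theorem toPath_apply (x : GA k Q rel) : toPath rel x = act PathMod.one x := rfl

theorem toPath_mul (x y : GA k Q rel) : toPath rel (x * y) = act (toPath rel x) y := by
  simp only [toPath_apply, act_mul]

theorem toPath_arr (a : Q.Arr) :
    toPath rel (arr k Q rel a) = Finsupp.single (Q.src a, [a]) 1 := by
  simp [toPath_apply, act_arr, PathMod.one, prolong, CanExtend, endpt]

/-- The element of `A` represented by a reversed word. -/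
def pathEl (rel : Q.Arr → Q.Arr → Prop) (s : Q.V) : List Q.Arr → GA k Q rel
  | [] => vtx k Q rel s
  | a :: w => pathEl rel s w * arr k Q rel a

theorem pathEl_mul_vtx (p : Q.V × List Q.Arr) :
    pathEl (k := k) rel p.1 p.2 * vtx k Q rel (endpt p) = pathEl rel p.1 p.2 := by
  obtain ⟨s, _ | ⟨a, w⟩⟩ := p
  · exact vtx_mul_self s
  · simp [pathEl, endpt, mul_assoc, arr_mul_vtx_tgt]

theorem pathEl_mul_arr (p : Q.V × List Q.Arr) (a : Q.Arr) (h : ¬ CanExtend rel p a) :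
    pathEl (k := k) rel p.1 p.2 * arr k Q rel a = 0 := by
  by_cases he : endpt p = Q.src a
  · obtain ⟨s, _ | ⟨b, w⟩⟩ := p
    · simp [CanExtend, he] at h
    · have hr : rel b a := by simpa [CanExtend, he] using h
      simp [pathEl, mul_assoc, arr_mul_arr_of_rel hr]
  · exact mul_arr_of_mul_vtx_eq (pathEl_mul_vtx p) he

/-- The retraction of `PathMod` onto `A`. -/
def ofPath (rel : Q.Arr → Q.Arr → Prop) : PathMod k Q →ₗ[k] GA k Q rel :=
  Finsupp.linearCombination k fun p => pathEl rel p.1 p.2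

theorem ofPath_act (m : PathMod k Q) (x : GA k Q rel) :
    ofPath rel (act m x) = ofPath rel m * x := by
  induction x using GA.induction generalizing m with
  | algebraMap c => rw [act_algebraMap, map_smul, ← Algebra.commutes, ← Algebra.smul_def]
  | vtx v =>
    rw [act_vtx]
    induction m using Finsupp.induction_linear with
    | zero => simp
    | add m m' h h' => simp [h, h', add_mul]
    | single p c =>
      simp only [ofPath, genAct_single, map_smul, Finsupp.linearCombination_single,
        smul_mul_assoc, mul_vtx_of_mul_vtx_eq (pathEl_mul_vtx p)]
      by_cases h : endpt p = v <;> simp [prolong, h]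
  | arr a =>
    rw [act_arr]
    induction m using Finsupp.induction_linear with
    | zero => simp
    | add m m' h h' => simp [h, h', add_mul]
    | single p c =>
      by_cases h : CanExtend rel p a
      · simp [ofPath, prolong, h, pathEl]
      · simp [ofPath, prolong, h, pathEl_mul_arr p a h]
  | mul x y hx hy => rw [act_mul, hy, hx, mul_assoc]
  | add x y hx hy => rw [act_add, map_add, hx, hy, mul_add]

theorem ofPath_toPath (x : GA k Q rel) : ofPath rel (toPath rel x) = x := by
  rw [toPath_apply, ofPath_act]
  have : ofPath (k := k) rel PathMod.one = 1 := by
    simp [ofPath, PathMod.one, pathEl, sum_vtx]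
  rw [this, one_mul]

theorem toPath_injective : Function.Injective (toPath (k := k) rel) :=
  Function.LeftInverse.injective ofPath_toPath

theorem act_arr_apply {s : Q.V} {w : List Q.Arr} {a : Q.Arr} (h : CanExtend rel (s, w) a)
    (m : PathMod k Q) : act m (arr k Q rel a) (s, a :: w) = m (s, w) := by
  rw [act_arr]
  induction m using Finsupp.induction_linear with
  | zero => simp
  | add m m' h h' => simp [h, h']
  | single p c =>
    by_cases hp : p = (s, w)
    · subst hp; simp [prolong, h]
    · have : (p.1, a :: p.2) ≠ (s, a :: w) := by
        simpa [Prod.ext_iff] using hp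
      by_cases h' : CanExtend rel p a <;> simp [prolong, h', hp, this]

theorem vtxHom_mkAlgHom (v : Q.V) (x : FreeAlgebra k (Q.V ⊕ Q.Arr)) :
    vtxHom k Q rel v (RingQuot.mkAlgHom k (GARel k Q rel) x) = vtxHomAux k Q v x := by
  simp [vtxHom, RingQuot.mkAlgHom]

theorem vtxHom_vtx (v w : Q.V) : vtxHom k Q rel v (vtx k Q rel w) = if w = v then 1 else 0 := by
  simp [vtx, vtxHom_mkAlgHom, vtxHomAux]

theorem vtxHom_arr (v : Q.V) (a : Q.Arr) : vtxHom k Q rel v (arr k Q rel a) = 0 := by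
  simp [arr, vtxHom_mkAlgHom, vtxHomAux]

theorem vtxHom_algebraMap (v : Q.V) (c : k) :
    vtxHom k Q rel v (algebraMap k (GA k Q rel) c) = c := by
  rw [← (RingQuot.mkAlgHom k (GARel k Q rel)).commutes c, vtxHom_mkAlgHom, AlgHom.commutes]
  rfl

theorem act_apply_nil (m : PathMod k Q) (x : GA k Q rel) (v : Q.V) :
    act m x (v, []) = m (v, []) * vtxHom k Q rel v x := by
  induction x using GA.induction generalizing m with
  | algebraMap c => simp [act_algebraMap, vtxHom_algebraMap, mul_comm]
  | vtx w =>
    rw [act_vtx, vtxHom_vtx]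
    induction m using Finsupp.induction_linear with
    | zero => simp
    | add m m' h h' => rw [map_add, Finsupp.add_apply, h, h', ← add_mul, Finsupp.add_apply]
    | single p c =>
      by_cases hp : p = (v, [])
      · subst hp
        by_cases h : v = w
        · simp [prolong, endpt, h]
        · simp [prolong, endpt, h, Ne.symm h]
      · by_cases h : endpt p = w <;> simp [prolong, h, hp]
  | arr a =>
    rw [act_arr, vtxHom_arr]
    induction m using Finsupp.induction_linear with
    | zero => simp
    | add m m' h h' => simp [h, h']
    | single p c =>
      by_cases h : CanExtend rel p a <;> simp [prolong, h]
  | mul x y hx hy => rw [act_mul, hy, hx, map_mul, mul_assoc]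
  | add x y hx hy => simp [act_add, hx, hy, mul_add]

theorem toPath_apply_nil (x : GA k Q rel) (v : Q.V) :
    toPath rel x (v, []) = vtxHom k Q rel v x := by
  rw [toPath_apply, act_apply_nil, PathMod.one_apply, one_mul]

theorem arr_ne_zero (a : Q.Arr) : arr k Q rel a ≠ 0 := by
  intro h
  have := toPath_arr (k := k) (rel := rel) a
  rw [h, map_zero, eq_comm, Finsupp.single_eq_zero] at this
  exact one_ne_zero this

/-- If every arrow can be followed, then `A` has no right socle. -/
theorem eq_zero_of_mul_arr_eq_zero (h : ∀ a : Q.Arr, ∃ b, Follows rel a b) {x : GA k Q rel}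
    (hx : ∀ a, x * arr k Q rel a = 0) : x = 0 := by
  apply toPath_injective
  rw [map_zero]
  ext ⟨s, w⟩
  obtain ⟨a, ha⟩ : ∃ a, CanExtend rel (s, w) a := by
    cases w with
    | nil =>
      obtain ⟨a, ha⟩ := exists_src_eq h s
      exact ⟨a, by simp [CanExtend, endpt, ha]⟩
    | cons b w =>
      obtain ⟨a, ha⟩ := h b
      exact ⟨a, by simpa [CanExtend, endpt, Follows] using ha⟩
  rw [← act_arr_apply ha, ← toPath_mul, hx a, map_zero]
  rfl

/-- Auxiliary values for `radMap`. -/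
def radMapAux (y : Q.Arr → GA k Q rel) : List Q.Arr → GA k Q rel
  | [] => 0
  | [a] => y a
  | b :: a :: w => radMapAux y (a :: w) * arr k Q rel b

/-- The linear map on `A` sending an arrow `a` to `y a`, and right `A`-linear on `A₊`. -/
def radMap (y : Q.Arr → GA k Q rel) : GA k Q rel →ₗ[k] GA k Q rel :=
  Finsupp.linearCombination k (fun p : Q.V × List Q.Arr => radMapAux y p.2) ∘ₗ toPath rel

theorem radMap_arr (y : Q.Arr → GA k Q rel) (a : Q.Arr) : radMap y (arr k Q rel a) = y a := by
  simp [radMap, toPath_arr, radMapAux]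

theorem radMapAux_mul_vtx {y : Q.Arr → GA k Q rel}
    (hy : ∀ a, y a * vtx k Q rel (Q.tgt a) = y a) (a : Q.Arr) (w : List Q.Arr) :
    radMapAux y (a :: w) * vtx k Q rel (Q.tgt a) = radMapAux y (a :: w) := by
  cases w with
  | nil => exact hy a
  | cons b w => simp [radMapAux, mul_assoc, arr_mul_vtx_tgt]

theorem radMapAux_mul_arr {y : Q.Arr → GA k Q rel}
    (hy' : ∀ a b, rel a b → y a * arr k Q rel b = 0) {a b : Q.Arr} (w : List Q.Arr)
    (h : rel a b) : radMapAux y (a :: w) * arr k Q rel b = 0 := by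
  cases w with
  | nil => exact hy' a b h
  | cons c w => simp [radMapAux, mul_assoc, arr_mul_arr_of_rel h]

theorem map_eq_zero_of_support {ι N : Type*} [AddCommGroup N] [Module k N]
    (L : (ι →₀ k) →ₗ[k] N) (m : ι →₀ k) (h : ∀ i, m i ≠ 0 → L (Finsupp.single i 1) = 0) :
    L m = 0 := by
  rw [← m.sum_single, Finsupp.sum, map_sum]
  refine Finset.sum_eq_zero fun i hi => ?_
  rw [← Finsupp.smul_single_one, map_smul, h i (Finsupp.mem_support_iff.1 hi), smul_zero]

theorem linearCombination_radMapAux_act {y : Q.Arr → GA k Q rel}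
    (hy : ∀ a, y a * vtx k Q rel (Q.tgt a) = y a)
    (hy' : ∀ a b, rel a b → y a * arr k Q rel b = 0) {m : PathMod k Q}
    (hm : ∀ v, m (v, []) = 0) (x : GA k Q rel) :
    Finsupp.linearCombination k (fun p : Q.V × List Q.Arr => radMapAux y p.2) (act m x) =
      Finsupp.linearCombination k (fun p : Q.V × List Q.Arr => radMapAux y p.2) m * x := by
  set R := Finsupp.linearCombination k (fun p : Q.V × List Q.Arr => radMapAux y p.2) with hR
  have of_single {g : Q.V ⊕ Q.Arr} {z : GA k Q rel}
      (h : ∀ s a w, R (prolong rel (s, a :: w) g) = radMapAux y (a :: w) * z)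
      {m : PathMod k Q} (hm : ∀ v, m (v, []) = 0) : R (genAct rel g m) = R m * z := by
    have := map_eq_zero_of_support (R ∘ₗ genAct rel g - LinearMap.mulRight k z ∘ₗ R) m
    simp only [LinearMap.sub_apply, LinearMap.comp_apply, LinearMap.mulRight_apply,
      sub_eq_zero] at this
    refine this fun p hp => ?_
    obtain ⟨s, _ | ⟨a, w⟩⟩ := p
    · exact absurd (hm s) hp
    · rw [genAct_single, one_smul, h, hR, Finsupp.linearCombination_single, one_smul]
  induction x using GA.induction generalizing m with
  | algebraMap c => rw [act_algebraMap, map_smul, ← Algebra.commutes, ← Algebra.smul_def]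
  | vtx v =>
    rw [act_vtx]
    refine of_single (fun s a w => ?_) hm
    rw [mul_vtx_of_mul_vtx_eq (radMapAux_mul_vtx hy a w)]
    by_cases h : Q.tgt a = v <;> simp [prolong, endpt, h, hR]
  | arr b =>
    rw [act_arr]
    refine of_single (fun s a w => ?_) hm
    by_cases h : CanExtend rel (s, a :: w) b
    · simp [prolong, h, hR, radMapAux]
    · rw [prolong, if_neg h, map_zero, eq_comm]
      by_cases he : Q.tgt a = Q.src b
      · exact radMapAux_mul_arr hy' w (by simpa [CanExtend, endpt, he] using h)
      · exact mul_arr_of_mul_vtx_eq (radMapAux_mul_vtx hy a w) he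
  | mul x z hx hz =>
    rw [act_mul, hz (fun v => by rw [act_apply_nil, hm, zero_mul]), hx hm, mul_assoc]
  | add x z hx hz => rw [act_add, map_add, hx hm, hz hm, mul_add]

theorem radMap_mul {y : Q.Arr → GA k Q rel} (hy : ∀ a, y a * vtx k Q rel (Q.tgt a) = y a)
    (hy' : ∀ a b, rel a b → y a * arr k Q rel b = 0) {x : GA k Q rel} (hx : SHom k Q rel x = 0)
    (z : GA k Q rel) : radMap y (x * z) = radMap y x * z := by
  have hx' (v : Q.V) : toPath rel x (v, []) = 0 := by
    rw [toPath_apply_nil]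
    exact congrFun hx v
  simp only [radMap, LinearMap.comp_apply, toPath_mul,
    linearCombination_radMapAux_act hy hy' hx']

end PathModule

section Ext

variable {k : Type} [Field k] {Q : Quiv} {rel : Q.Arr → Q.Arr → Prop}

theorem SHom_arr (a : Q.Arr) : SHom k Q rel (arr k Q rel a) = 0 :=
  funext fun v => vtxHom_arr v a

theorem SHom_surjective : Function.Surjective (SHom k Q rel) := fun c => by
  refine ⟨∑ w, algebraMap k _ (c w) * vtx k Q rel w, funext fun v => ?_⟩
  change vtxHom k Q rel v _ = _
  simp [vtxHom_vtx, vtxHom_algebraMap]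

variable (k Q rel) in
/-- The projection of `A` onto `S`. -/
def toS : AModR k Q rel ⟶ SModR k Q rel :=
  ModuleCat.ofHom (X := AModR k Q rel) (Y := SModR k Q rel)
    { toFun := fun x : GA k Q rel => SHom k Q rel x
      map_add' := fun x y : GA k Q rel => map_add (SHom k Q rel) x y
      map_smul' := fun r (x : GA k Q rel) => (map_mul (SHom k Q rel) x r.unop).trans (mul_comm _ _) }

theorem toS_surjective : Function.Surjective (toS k Q rel) :=
  SHom_surjective (k := k) (Q := Q) (rel := rel)

instance : Module.Projective (GA k Q rel)ᵐᵒᵖ (GA k Q rel) :=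
  .of_equiv
    { (MulOpposite.opAddEquiv (α := GA k Q rel)).symm with
      map_smul' := fun _ _ => rfl : (GA k Q rel)ᵐᵒᵖ ≃ₗ[(GA k Q rel)ᵐᵒᵖ] GA k Q rel }

theorem extNZ_zero_of_not_follows {a : Q.Arr} (ha : ∀ b, ¬ Follows rel a b) :
    extSNZ k Q rel 0 := by
  have hmul (x : GA k Q rel) :
      arr k Q rel a * x = algebraMap k _ (vtxHom k Q rel (Q.tgt a) x) * arr k Q rel a := by
    induction x using GA.induction with
    | algebraMap c => rw [vtxHom_algebraMap, Algebra.commutes]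
    | vtx v =>
      rw [mul_vtx_of_mul_vtx_eq (arr_mul_vtx_tgt a), vtxHom_vtx]
      by_cases h : Q.tgt a = v
      · simp [h]
      · simp [h, Ne.symm h]
    | arr b =>
      rw [vtxHom_arr, map_zero, zero_mul]
      by_cases h : Q.tgt a = Q.src b
      · exact arr_mul_arr_of_rel (by simpa [Follows, h] using ha b)
      · exact mul_arr_of_mul_vtx_eq (arr_mul_vtx_tgt a) h
    | mul x y hx hy =>
      rw [← mul_assoc, hx, mul_assoc, hy, ← mul_assoc, map_mul, map_mul]
    | add x y hx hy => rw [mul_add, hx, hy, map_add, map_add, add_mul]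
  refine (extNZ_zero_iff _ _).2
    ⟨ModuleCat.ofHom (X := SModR k Q rel) (Y := AModR k Q rel)
      { toFun := fun c : Q.V → k => (algebraMap k _ (c (Q.tgt a)) * arr k Q rel a : GA k Q rel)
        map_add' := fun (c d : Q.V → k) => ?_
        map_smul' := fun r (c : Q.V → k) => ?_ }, fun h => ?_⟩
  · change algebraMap k (GA k Q rel) (c (Q.tgt a) + d (Q.tgt a)) * arr k Q rel a = _
    rw [map_add, add_mul]
    rfl
  · change algebraMap k (GA k Q rel) (vtxHom k Q rel (Q.tgt a) r.unop * c (Q.tgt a)) *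
      arr k Q rel a = (algebraMap k _ (c (Q.tgt a)) * arr k Q rel a) * r.unop
    rw [mul_assoc, hmul, ← mul_assoc, map_mul, ← map_mul, ← map_mul, mul_comm]
  · have h1 := congrArg (fun f : SModR k Q rel ⟶ AModR k Q rel => f (1 : Q.V → k)) h
    replace h1 : algebraMap k (GA k Q rel) 1 * arr k Q rel a = 0 := h1
    rw [map_one, one_mul] at h1
    exact arr_ne_zero a h1

theorem not_extNZ_zero (h : ∀ a : Q.Arr, ∃ b, Follows rel a b) : ¬ extSNZ k Q rel 0 := by
  intro hext
  obtain ⟨f, hf⟩ := (extNZ_zero_iff _ _).1 hext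
  let g : GA k Q rel →ₗ[(GA k Q rel)ᵐᵒᵖ] GA k Q rel := (toS k Q rel ≫ f).hom
  have hg (x z : GA k Q rel) : g (x * z) = g x * z := g.map_smul (MulOpposite.op z) x
  have h0 (a : Q.Arr) : g (arr k Q rel a) = 0 :=
    (congrArg f (SHom_arr a)).trans (map_zero f.hom)
  have h1 : g 1 = 0 := eq_zero_of_mul_arr_eq_zero h fun a => by rw [← hg, one_mul, h0]
  have h2 (x : GA k Q rel) : g x = 0 := by rw [← one_mul x, hg, h1, zero_mul]
  refine hf (ModuleCat.hom_ext (LinearMap.ext fun c => ?_))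
  obtain ⟨x, rfl⟩ := toS_surjective c
  exact h2 x

/-- If `Ext¹(S, A)` vanishes, then every right linear map `A₊ → A` is a left multiplication. -/
theorem exists_mul_arr_eq (hext : ¬ extSNZ k Q rel 1) {y : Q.Arr → GA k Q rel}
    (hy : ∀ a, y a * vtx k Q rel (Q.tgt a) = y a)
    (hy' : ∀ a b, rel a b → y a * arr k Q rel b = 0) :
    ∃ x : GA k Q rel, ∀ a, x * arr k Q rel a = y a := by
  let K : ModuleCat (GA k Q rel)ᵐᵒᵖ := ModuleCat.of _ (LinearMap.ker (toS k Q rel).hom)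
  let i : K ⟶ AModR k Q rel := ModuleCat.ofHom (LinearMap.ker (toS k Q rel).hom).subtype
  have w : i ≫ toS k Q rel = 0 := ModuleCat.hom_ext (LinearMap.ext fun z => z.2)
  have : Mono i := (ModuleCat.mono_iff_injective i).2 Subtype.val_injective
  have : Epi (toS k Q rel) := (ModuleCat.epi_iff_surjective _).2 toS_surjective
  have : Projective (AModR k Q rel) :=
    (IsProjective.iff_projective _).1
      (inferInstanceAs (Module.Projective (GA k Q rel)ᵐᵒᵖ (GA k Q rel)))
  let φ : K ⟶ AModR k Q rel := ModuleCat.ofHom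
    { toFun := fun z => (radMap y (z.1 : GA k Q rel) : GA k Q rel)
      map_add' := fun z z' => map_add (radMap y) z.1 z'.1
      map_smul' := fun r z => radMap_mul hy hy' (x := z.1) (LinearMap.mem_ker.1 z.2) r.unop }
  obtain ⟨ψ, hψ⟩ := exists_extension_of_not_extNZ_one i (toS k Q rel) w
    ((ShortComplex.moduleCat_exact_iff _).2 fun x hx => ⟨⟨x, hx⟩, rfl⟩) hext φ
  let g : GA k Q rel →ₗ[(GA k Q rel)ᵐᵒᵖ] GA k Q rel := ψ.hom
  have hg (x z : GA k Q rel) : g (x * z) = g x * z := g.map_smul (MulOpposite.op z) x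
  refine ⟨g 1, fun a => ?_⟩
  have ha : (toS k Q rel).hom (arr k Q rel a) = 0 := SHom_arr (k := k) (rel := rel) a
  have h : g (arr k Q rel a) = radMap y (arr k Q rel a) :=
    congrArg (fun f : K ⟶ AModR k Q rel => f ⟨arr k Q rel a, ha⟩) hψ
  rw [← hg, one_mul, h, radMap_arr]

open Classical in
theorem extNZ_one (hgentle : IsGentleRel Q rel) (h : ∀ a : Q.Arr, ∃ b, Follows rel a b) :
    extSNZ k Q rel 1 := by
  by_contra hext
  by_cases hsrc : ∀ b b' : Q.Arr, Q.src b = Q.src b' → b = b'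
  · obtain ⟨x, hx⟩ := exists_mul_arr_eq hext (y := fun a => vtx k Q rel (Q.tgt a))
      (fun a => vtx_mul_self _) fun a b hab => by
        obtain ⟨c, hac, hc⟩ := h a
        rw [hsrc b c ((hgentle.rel_comp a b hab).symm.trans hac)] at hab
        exact absurd hab hc
    obtain ⟨a⟩ := Q.nonemptyA
    have := congrArg (vtxHom k Q rel (Q.tgt a)) (hx a)
    simp [vtxHom_arr, vtxHom_vtx] at this
  · push Not at hsrc
    obtain ⟨b, b', hbb', hne⟩ := hsrc
    obtain ⟨x, hx⟩ := exists_mul_arr_eq hext (y := fun a => if a = b then arr k Q rel a else 0)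
      (fun a => by split_ifs <;> simp [arr_mul_vtx_tgt]) fun a c hac => by
        split_ifs <;> simp [arr_mul_arr_of_rel hac]
    have hcoeff (a : Q.Arr) : toPath rel (x * arr k Q rel a) (Q.src a, [a]) =
        toPath rel x (Q.src a, []) := by
      rw [toPath_mul, act_arr_apply (by simp [CanExtend, endpt])]
    have h1 := hcoeff b
    have h2 := hcoeff b'
    rw [hx, if_pos rfl, toPath_arr] at h1
    rw [hx, if_neg hne.symm, map_zero, ← hbb', ← h1] at h2
    simp at h2

end Ext

/-- **Corollary 4.10 (cor:depth).** Let `A = kQ/I` be a (locally) gentle algebra.  Then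
`depth A = 0` if `A` has a finite maximal path, and `depth A = 1` otherwise. -/
theorem statement13 (k : Type) [Field k] [CharZero k] (Q : Quiv)
    (rel : Q.Arr → Q.Arr → Prop) (hgentle : IsGentleRel Q rel) :
    ((∃ l : List Q.Arr, FiniteMaxWord rel l) → depth k Q rel = 0) ∧
    ((¬ ∃ l : List Q.Arr, FiniteMaxWord rel l) → depth k Q rel = 1) := by
  constructor
  · rintro ⟨l, hl⟩
    obtain ⟨a, ha⟩ := hl.exists_not_follows
    exact le_antisymm (sInf_le ⟨0, rfl, extNZ_zero_of_not_follows ha⟩) bot_le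
  · intro hno
    have h : ∀ a : Q.Arr, ∃ b, Follows rel a b := by
      by_contra! hcon
      obtain ⟨a, ha⟩ := hcon
      exact hno (exists_finiteMaxWord hgentle ha)
    refine le_antisymm (sInf_le ⟨1, rfl, extNZ_one hgentle h⟩) (le_sInf ?_)
    rintro _ ⟨i, rfl, hi⟩
    have : i ≠ 0 := fun h0 => not_extNZ_zero h (h0 ▸ hi)
    exact_mod_cast Nat.one_le_iff_ne_zero.2 this

end LocGentle
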